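/- Let L1, L2 > 0 and Ω = (0,L1)×(0,L2), with boundary sides Γ_W = {x=0}, Γ_E = {x=L1}, Γ_S = {y=0}, Γ_N = {y=L2}. Let μ1, μ2 be continuously differentiable real-valued functions on the closed rectangle with μ2 ≥ c0 for some constant c0 > 0. For each j ∈ {W,E,S,N} let (a_j, b_j) ∈ ℝ² with (a_j, b_j) ≠ (0,0), and assume the 4×2 real matrix whose rows are (a_W, b_W), (a_E, b_E), (a_S, b_S), (a_N, b_N) has rank 2. If u = (u1, u2) is continuously differentiable on the closed rectangle, satisfies ∂x u(x,y) + [[μ1(x,y), −μ2(x,y)], [μ2(x,y), μ1(x,y)]]·∂y u(x,y) = 0 at every point of Ω, and satisfies a_j·u1 + b_j·u2 = 0 at every point of Γ_j for each j, then u is identically zero on the closed rectangle. -/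

import Mathlib

open Set MeasureTheory Matrix

/-- The closed rectangle `[0,L1] × [0,L2]`. -/
def Rect (L1 L2 : ℝ) : Set (ℝ × ℝ) := Icc 0 L1 ×ˢ Icc 0 L2

/-- The open rectangle `Ω = (0,L1) × (0,L2)`. -/
def Om (L1 L2 : ℝ) : Set (ℝ × ℝ) := Ioo 0 L1 ×ˢ Ioo 0 L2

/-- The partial derivative `∂x f` on the closed rectangle. -/
noncomputable def pdx (L1 L2 : ℝ) (f : ℝ × ℝ → ℝ) (p : ℝ × ℝ) : ℝ :=
  fderivWithin ℝ f (Rect L1 L2) p (1, 0)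

/-- The partial derivative `∂y f` on the closed rectangle. -/
noncomputable def pdy (L1 L2 : ℝ) (f : ℝ × ℝ → ℝ) (p : ℝ × ℝ) : ℝ :=
  fderivWithin ℝ f (Rect L1 L2) p (0, 1)

/-- Derivative at `s = t` of `∫ (f(s,y) - f(t,y)) h(s,y) dy`, where `h` is only continuous. -/
theorem hasDerivAt_integral_sub_mul {a b L t : ℝ} {f fx h : ℝ × ℝ → ℝ}
    (hf : Continuous f) (hfx : Continuous fx) (hh : Continuous h)
    (hd : ∀ s ∈ Ioo a b, ∀ y, HasDerivAt (fun s => f (s, y)) (fx (s, y)) s)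
    (ht : t ∈ Ioo a b) :
    HasDerivAt (fun s => ∫ y in (0 : ℝ)..L, (f (s, y) - f (t, y)) * h (s, y))
      (∫ y in (0 : ℝ)..L, fx (t, y) * h (t, y)) t := by
  have hK : IsCompact (Icc a b ×ˢ uIcc (0 : ℝ) L) := isCompact_Icc.prod isCompact_uIcc
  obtain ⟨C, hC⟩ := hK.exists_bound_of_continuousOn hfx.continuousOn
  obtain ⟨D, hD⟩ := hK.exists_bound_of_continuousOn hh.continuousOn
  rw [hasDerivAt_iff_tendsto_slope]
  have hslope : slope (fun s => ∫ y in (0 : ℝ)..L, (f (s, y) - f (t, y)) * h (s, y)) t =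
      fun s => ∫ y in (0 : ℝ)..L, slope (fun s => f (s, y)) t s * h (s, y) := by
    funext s
    simp only [slope_def_field, sub_self, zero_mul, intervalIntegral.integral_zero, sub_zero]
    rw [← intervalIntegral.integral_div]
    congr 1
    funext y
    ring
  rw [hslope]
  refine intervalIntegral.tendsto_integral_filter_of_dominated_convergence
    (fun _ => C * D) ?_ ?_ intervalIntegrable_const ?_
  · refine Filter.Eventually.of_forall fun s => Continuous.aestronglyMeasurable ?_
    simp only [slope_def_field]
    fun_prop
  · filter_upwards [mem_nhdsWithin_of_mem_nhds (Ioo_mem_nhds ht.1 ht.2), self_mem_nhdsWithin]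
      with s hs hst
    refine Filter.Eventually.of_forall fun y hy => ?_
    have hy' := uIoc_subset_uIcc hy
    have hC0 : ‖f (s, y) - f (t, y)‖ ≤ C * ‖s - t‖ :=
      (convex_Ioo a b).norm_image_sub_le_of_norm_hasDerivWithin_le
        (f := fun s => f (s, y)) (f' := fun s => fx (s, y))
        (fun r hr => (hd r hr y).hasDerivWithinAt)
        (fun r hr => hC (r, y) ⟨Ioo_subset_Icc_self hr, hy'⟩) ht hs
    have hD0 := hD (s, y) ⟨Ioo_subset_Icc_self hs, hy'⟩
    have hC1 : ‖slope (fun s => f (s, y)) t s‖ ≤ C := by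
      rw [slope_def_field, norm_div, div_le_iff₀ (norm_pos_iff.2 (sub_ne_zero.2 hst))]
      exact hC0
    rw [norm_mul]
    exact mul_le_mul hC1 hD0 (norm_nonneg _) ((norm_nonneg _).trans hC1)
  · refine Filter.Eventually.of_forall fun y _ => Filter.Tendsto.mul ?_ ?_
    · exact (hasDerivAt_iff_tendsto_slope.1 (hd t ht y))
    · exact ((hh.comp (Continuous.prodMk_left y)).tendsto t).mono_left nhdsWithin_le_nhds

/-- A form of Green's theorem for `f dg` on vertical strips, for functions that are merely `C¹`. -/
theorem hasDerivAt_integral_mul_partial {a b L t : ℝ} {f fx fy g gx gy : ℝ × ℝ → ℝ}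
    (hL : 0 ≤ L) (hf : Continuous f) (hfx : Continuous fx) (hfy : Continuous fy)
    (hg : Continuous g) (hgx : Continuous gx) (hgy : Continuous gy)
    (hdfx : ∀ s ∈ Ioo a b, ∀ y, HasDerivAt (fun s => f (s, y)) (fx (s, y)) s)
    (hdgx : ∀ s ∈ Ioo a b, ∀ y, HasDerivAt (fun s => g (s, y)) (gx (s, y)) s)
    (hdfy : ∀ s, ∀ y ∈ Ioo 0 L, HasDerivAt (fun y => f (s, y)) (fy (s, y)) y)
    (hdgy : ∀ s, ∀ y ∈ Ioo 0 L, HasDerivAt (fun y => g (s, y)) (gy (s, y)) y)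
    (ht : t ∈ Ioo a b) :
    HasDerivAt (fun s => ∫ y in (0 : ℝ)..L, f (s, y) * gy (s, y))
      ((∫ y in (0 : ℝ)..L, (fx (t, y) * gy (t, y) - fy (t, y) * gx (t, y))) +
        (f (t, L) * gx (t, L) - f (t, 0) * gx (t, 0))) t := by
  have h1 := hasDerivAt_integral_sub_mul (L := L) hf hfx hgy hdfx ht
  have h2 := hasDerivAt_integral_sub_mul (L := L) (h := fun p => fy (t, p.2)) hg hgx
    (by fun_prop) hdgx ht
  have h3 := (((hdgx t ht L).sub_const (g (t, L))).const_mul (f (t, L))).sub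
    (((hdgx t ht 0).sub_const (g (t, 0))).const_mul (f (t, 0)))
  have h4 := (((h1.sub h2).add h3).add_const (∫ y in (0 : ℝ)..L, f (t, y) * gy (t, y)))
  have ii : ∀ φ : ℝ → ℝ, Continuous φ → IntervalIntegrable φ volume 0 L :=
    fun φ hφ => hφ.intervalIntegrable 0 L
  refine (h4.congr_deriv ?_).congr_of_eventuallyEq (Filter.Eventually.of_forall fun s => ?_)
  · rw [intervalIntegral.integral_sub (ii _ (by fun_prop)) (ii _ (by fun_prop))]
    simp only [mul_comm]
  · have key := intervalIntegral.integral_mul_deriv_eq_deriv_mul_of_hasDerivAt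
      (a := 0) (b := L) (u := fun y => f (t, y)) (v := fun y => g (s, y) - g (t, y))
      (u' := fun y => fy (t, y)) (v' := fun y => gy (s, y) - gy (t, y))
      (by fun_prop) (by fun_prop)
      (fun y hy => hdfy t y (by simpa [hL] using hy))
      (fun y hy => (hdgy s y (by simpa [hL] using hy)).sub (hdgy t y (by simpa [hL] using hy)))
      (ii _ (by fun_prop)) (ii _ (by fun_prop))
    have e1 : (∫ y in (0 : ℝ)..L, (g (s, y) - g (t, y)) * fy (t, y)) =
        ∫ y in (0 : ℝ)..L, fy (t, y) * (g (s, y) - g (t, y)) := by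
      simp only [mul_comm]
    have e2 : (∫ y in (0 : ℝ)..L, f (s, y) * gy (s, y)) =
        (∫ y in (0 : ℝ)..L, (f (s, y) - f (t, y)) * gy (s, y)) +
        (∫ y in (0 : ℝ)..L, f (t, y) * (gy (s, y) - gy (t, y))) +
        ∫ y in (0 : ℝ)..L, f (t, y) * gy (t, y) := by
      rw [← intervalIntegral.integral_add (ii _ (by fun_prop)) (ii _ (by fun_prop)),
        ← intervalIntegral.integral_add (ii _ (by fun_prop)) (ii _ (by fun_prop))]
      congr 1
      funext y
      ring
    simp only [Pi.add_apply, Pi.sub_apply]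
    rw [e1, e2, key]
    ring

/-- The projection of the plane onto a closed rectangle. -/
def clampRect (L1 L2 : ℝ) (p : ℝ × ℝ) : ℝ × ℝ :=
  (max 0 (min L1 p.1), max 0 (min L2 p.2))

theorem continuous_clampRect (L1 L2 : ℝ) : Continuous (clampRect L1 L2) := by
  unfold clampRect
  fun_prop

theorem clampRect_mem {L1 L2 : ℝ} (h1 : 0 ≤ L1) (h2 : 0 ≤ L2) (p : ℝ × ℝ) :
    clampRect L1 L2 p ∈ Rect L1 L2 :=
  ⟨⟨le_max_left _ _, max_le h1 (min_le_left _ _)⟩,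
    ⟨le_max_left _ _, max_le h2 (min_le_left _ _)⟩⟩

theorem clamp_eq_self {L s : ℝ} (hs : s ∈ Icc 0 L) : max 0 (min L s) = s := by
  rw [min_eq_right hs.2, max_eq_right hs.1]

theorem clampRect_eq_self {L1 L2 : ℝ} {p : ℝ × ℝ} (hp : p ∈ Rect L1 L2) :
    clampRect L1 L2 p = p :=
  Prod.ext (clamp_eq_self hp.1) (clamp_eq_self hp.2)

theorem uniqueDiffOn_rect {L1 L2 : ℝ} (h1 : 0 < L1) (h2 : 0 < L2) :
    UniqueDiffOn ℝ (Rect L1 L2) :=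
  (uniqueDiffOn_Icc h1).prod (uniqueDiffOn_Icc h2)

theorem closure_om {L1 L2 : ℝ} (h1 : 0 < L1) (h2 : 0 < L2) :
    closure (Om L1 L2) = Rect L1 L2 := by
  rw [Om, closure_prod_eq, closure_Ioo h1.ne, closure_Ioo h2.ne, Rect]

theorem om_subset_rect (L1 L2 : ℝ) : Om L1 L2 ⊆ Rect L1 L2 :=
  prod_mono Ioo_subset_Icc_self Ioo_subset_Icc_self

theorem continuousOn_pdx {L1 L2 : ℝ} (h1 : 0 < L1) (h2 : 0 < L2) {f : ℝ × ℝ → ℝ}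
    (hf : ContDiffOn ℝ 1 f (Rect L1 L2)) : ContinuousOn (pdx L1 L2 f) (Rect L1 L2) :=
  (hf.continuousOn_fderivWithin (uniqueDiffOn_rect h1 h2) le_rfl).clm_apply continuousOn_const

theorem continuousOn_pdy {L1 L2 : ℝ} (h1 : 0 < L1) (h2 : 0 < L2) {f : ℝ × ℝ → ℝ}
    (hf : ContDiffOn ℝ 1 f (Rect L1 L2)) : ContinuousOn (pdy L1 L2 f) (Rect L1 L2) :=
  (hf.continuousOn_fderivWithin (uniqueDiffOn_rect h1 h2) le_rfl).clm_apply continuousOn_const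

theorem ContinuousOn.comp_clampRect {L1 L2 : ℝ} (h1 : 0 ≤ L1) (h2 : 0 ≤ L2) {f : ℝ × ℝ → ℝ}
    (hf : ContinuousOn f (Rect L1 L2)) : Continuous (f ∘ clampRect L1 L2) :=
  hf.comp_continuous (continuous_clampRect L1 L2) (clampRect_mem h1 h2)

theorem hasDerivAt_fst_comp_clampRect {L1 L2 : ℝ} (h2 : 0 ≤ L2) {f : ℝ × ℝ → ℝ}
    (hf : ContDiffOn ℝ 1 f (Rect L1 L2)) {s : ℝ} (hs : s ∈ Ioo 0 L1) (y : ℝ) :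
    HasDerivAt (fun s => (f ∘ clampRect L1 L2) (s, y))
      ((pdx L1 L2 f ∘ clampRect L1 L2) (s, y)) s := by
  have hy : max 0 (min L2 y) ∈ Icc 0 L2 := ⟨le_max_left _ _, max_le h2 (min_le_left _ _)⟩
  have hmem : (s, max 0 (min L2 y)) ∈ Rect L1 L2 := ⟨Ioo_subset_Icc_self hs, hy⟩
  have hd := ((hf.differentiableOn one_ne_zero _ hmem).hasFDerivWithinAt).comp_hasDerivWithinAt
    (s := Icc 0 L1) s
    ((hasDerivAt_id s).prodMk (hasDerivAt_const s (max 0 (min L2 y)))).hasDerivWithinAt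
    (fun r hr => show (r, _) ∈ Rect L1 L2 from ⟨hr, hy⟩)
  have hd' := hd.hasDerivAt (Icc_mem_nhds hs.1 hs.2)
  have hval : (pdx L1 L2 f ∘ clampRect L1 L2) (s, y) =
      fderivWithin ℝ f (Rect L1 L2) (s, max 0 (min L2 y)) (1, 0) := by
    simp only [Function.comp, pdx, clampRect, clamp_eq_self (Ioo_subset_Icc_self hs)]
  rw [hval]
  refine hd'.congr_of_eventuallyEq ?_
  filter_upwards [Ioo_mem_nhds hs.1 hs.2] with r hr
  simp only [Function.comp, clampRect, clamp_eq_self (Ioo_subset_Icc_self hr), id]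

theorem hasDerivAt_snd_comp_clampRect {L1 L2 : ℝ} (h1 : 0 ≤ L1) {f : ℝ × ℝ → ℝ}
    (hf : ContDiffOn ℝ 1 f (Rect L1 L2)) (x : ℝ) {s : ℝ} (hs : s ∈ Ioo 0 L2) :
    HasDerivAt (fun s => (f ∘ clampRect L1 L2) (x, s))
      ((pdy L1 L2 f ∘ clampRect L1 L2) (x, s)) s := by
  have hx : max 0 (min L1 x) ∈ Icc 0 L1 := ⟨le_max_left _ _, max_le h1 (min_le_left _ _)⟩
  have hmem : (max 0 (min L1 x), s) ∈ Rect L1 L2 := ⟨hx, Ioo_subset_Icc_self hs⟩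
  have hd := ((hf.differentiableOn one_ne_zero _ hmem).hasFDerivWithinAt).comp_hasDerivWithinAt
    (s := Icc 0 L2) s
    ((hasDerivAt_const s (max 0 (min L1 x))).prodMk (hasDerivAt_id s)).hasDerivWithinAt
    (fun r hr => ⟨hx, hr⟩)
  have hd' := hd.hasDerivAt (Icc_mem_nhds hs.1 hs.2)
  have hval : (pdy L1 L2 f ∘ clampRect L1 L2) (x, s) =
      fderivWithin ℝ f (Rect L1 L2) (max 0 (min L1 x), s) (0, 1) := by
    simp only [Function.comp, pdy, clampRect, clamp_eq_self (Ioo_subset_Icc_self hs)]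
  rw [hval]
  refine hd'.congr_of_eventuallyEq ?_
  filter_upwards [Ioo_mem_nhds hs.1 hs.2] with r hr
  simp only [Function.comp, clampRect, clamp_eq_self (Ioo_subset_Icc_self hr)]

theorem det_eq_zero_of_common_kernel {a b p q r s : ℝ} (h0 : (a, b) ≠ (0, 0))
    (h1 : a * p + b * q = 0) (h2 : a * r + b * s = 0) : p * s - q * r = 0 := by
  have ha : a * (p * s - q * r) = 0 := by linear_combination s * h1 - q * h2
  have hb : b * (p * s - q * r) = 0 := by linear_combination p * h2 - r * h1
  by_contra h
  exact h0 (Prod.ext ((mul_eq_zero.1 ha).resolve_right h) ((mul_eq_zero.1 hb).resolve_right h))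

/-- If a curve stays in a line through the origin, its velocity is parallel to its position. -/
theorem det_eq_zero_of_hasDerivAt {a b L s p' q' : ℝ} {p q : ℝ → ℝ} (h0 : (a, b) ≠ (0, 0))
    (hs : s ∈ Ioo 0 L) (h : ∀ r ∈ Icc 0 L, a * p r + b * q r = 0)
    (hp : HasDerivAt p p' s) (hq : HasDerivAt q q' s) : p s * q' - q s * p' = 0 := by
  refine det_eq_zero_of_common_kernel h0 (h s (Ioo_subset_Icc_self hs)) ?_
  refine ((hp.const_mul a).add (hq.const_mul b)).unique
    ((hasDerivAt_const s (0 : ℝ)).congr_of_eventuallyEq ?_)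
  filter_upwards [Ioo_mem_nhds hs.1 hs.2] with r hr
  exact h r (Ioo_subset_Icc_self hr)

theorem Matrix.eq_zero_of_mulVec_eq_zero_of_rank {m n : ℕ} {A : Matrix (Fin m) (Fin n) ℝ}
    (hA : A.rank = n) {v : Fin n → ℝ} (hv : A *ᵥ v = 0) : v = 0 := by
  have h := LinearMap.finrank_range_add_finrank_ker A.mulVecLin
  rw [Module.finrank_fin_fun] at h
  have hA' : Module.finrank ℝ (LinearMap.range A.mulVecLin) = n := hA
  have hker : LinearMap.ker A.mulVecLin = ⊥ := Submodule.finrank_eq_zero.1 (by omega)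
  have hmem : v ∈ LinearMap.ker A.mulVecLin := by simpa using hv
  rw [hker] at hmem
  simpa using hmem

theorem eq_of_pdx_pdy_eq_zero {L1 L2 : ℝ} {f : ℝ × ℝ → ℝ}
    (hf : ContDiffOn ℝ 1 f (Rect L1 L2))
    (hx : ∀ p ∈ Rect L1 L2, pdx L1 L2 f p = 0) (hy : ∀ p ∈ Rect L1 L2, pdy L1 L2 f p = 0)
    {p q : ℝ × ℝ} (hp : p ∈ Rect L1 L2) (hq : q ∈ Rect L1 L2) : f p = f q := by
  have hconv : Convex ℝ (Rect L1 L2) := (convex_Icc 0 L1).prod (convex_Icc 0 L2)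
  refine hconv.is_const_of_fderivWithin_eq_zero (𝕜 := ℝ)
    (hf.differentiableOn one_ne_zero) (fun r hr => ?_) hp hq
  ext
  · simpa [pdx] using hx r hr
  · simpa [pdy] using hy r hr

/-- Uniqueness for the first-order elliptic system
`∂x u + [[μ1, -μ2], [μ2, μ1]]·∂y u = 0` with `μ2 ≥ c0 > 0`, under one homogeneous
linear boundary condition on each side of the rectangle, the four conditions forming a
rank-2 family: the only solution is `u ≡ 0`. -/
theorem stmt12 (L1 L2 c0 : ℝ) (hL1 : 0 < L1) (hL2 : 0 < L2) (hc0 : 0 < c0)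
    (μ1 μ2 : ℝ × ℝ → ℝ)
    (hμ1 : ContDiffOn ℝ 1 μ1 (Rect L1 L2)) (hμ2 : ContDiffOn ℝ 1 μ2 (Rect L1 L2))
    (hμ2c : ∀ p ∈ Rect L1 L2, c0 ≤ μ2 p)
    (aW bW aE bE aS bS aN bN : ℝ)
    (hW0 : (aW, bW) ≠ (0, 0)) (hE0 : (aE, bE) ≠ (0, 0))
    (hS0 : (aS, bS) ≠ (0, 0)) (hN0 : (aN, bN) ≠ (0, 0))
    (hrank : (!![aW, bW; aE, bE; aS, bS; aN, bN] : Matrix (Fin 4) (Fin 2) ℝ).rank = 2)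
    (u1 u2 : ℝ × ℝ → ℝ)
    (hu1 : ContDiffOn ℝ 1 u1 (Rect L1 L2)) (hu2 : ContDiffOn ℝ 1 u2 (Rect L1 L2))
    (hpde1 : ∀ p ∈ Om L1 L2,
      pdx L1 L2 u1 p + μ1 p * pdy L1 L2 u1 p - μ2 p * pdy L1 L2 u2 p = 0)
    (hpde2 : ∀ p ∈ Om L1 L2,
      pdx L1 L2 u2 p + μ2 p * pdy L1 L2 u1 p + μ1 p * pdy L1 L2 u2 p = 0)
    (hW : ∀ y ∈ Icc (0 : ℝ) L2, aW * u1 (0, y) + bW * u2 (0, y) = 0)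
    (hE : ∀ y ∈ Icc (0 : ℝ) L2, aE * u1 (L1, y) + bE * u2 (L1, y) = 0)
    (hS : ∀ x ∈ Icc (0 : ℝ) L1, aS * u1 (x, 0) + bS * u2 (x, 0) = 0)
    (hN : ∀ x ∈ Icc (0 : ℝ) L1, aN * u1 (x, L2) + bN * u2 (x, L2) = 0) :
    ∀ p ∈ Rect L1 L2, u1 p = 0 ∧ u2 p = 0 := by
  have cx1 := continuousOn_pdx hL1 hL2 hu1
  have cy1 := continuousOn_pdy hL1 hL2 hu1
  have cx2 := continuousOn_pdx hL1 hL2 hu2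
  have cy2 := continuousOn_pdy hL1 hL2 hu2
  have hcl : Rect L1 L2 ⊆ closure (Om L1 L2) := (closure_om hL1 hL2).ge
  have extend : ∀ φ : ℝ × ℝ → ℝ, ContinuousOn φ (Rect L1 L2) → (∀ p ∈ Om L1 L2, φ p = 0) →
      ∀ p ∈ Rect L1 L2, φ p = 0 := fun φ hφ h0 =>
    Set.EqOn.of_subset_closure (g := fun _ => 0) h0 hφ continuousOn_const
      (om_subset_rect L1 L2) hcl
  have pde1 : ∀ p ∈ Rect L1 L2,
      pdx L1 L2 u1 p + μ1 p * pdy L1 L2 u1 p - μ2 p * pdy L1 L2 u2 p = 0 :=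
    extend _ ((cx1.add (hμ1.continuousOn.mul cy1)).sub (hμ2.continuousOn.mul cy2)) hpde1
  have pde2 : ∀ p ∈ Rect L1 L2,
      pdx L1 L2 u2 p + μ2 p * pdy L1 L2 u1 p + μ1 p * pdy L1 L2 u2 p = 0 :=
    extend _ ((cx2.add (hμ2.continuousOn.mul cy1)).add (hμ1.continuousOn.mul cy2)) hpde2
  have hJ : ∀ p ∈ Rect L1 L2,
      pdx L1 L2 u1 p * pdy L1 L2 u2 p - pdy L1 L2 u1 p * pdx L1 L2 u2 p =
        μ2 p * (pdy L1 L2 u1 p ^ 2 + pdy L1 L2 u2 p ^ 2) := fun p hp => by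
    linear_combination pdy L1 L2 u2 p * pde1 p hp - pdy L1 L2 u1 p * pde2 p hp
  set P := clampRect L1 L2
  have hPmem : ∀ p, P p ∈ Rect L1 L2 := clampRect_mem hL1.le hL2.le
  have hPeq : ∀ {p}, p ∈ Rect L1 L2 → P p = p := clampRect_eq_self
  have Cf := hu1.continuousOn.comp_clampRect hL1.le hL2.le
  have Cg := hu2.continuousOn.comp_clampRect hL1.le hL2.le
  have Cfx := cx1.comp_clampRect hL1.le hL2.le
  have Cfy := cy1.comp_clampRect hL1.le hL2.le
  have Cgx := cx2.comp_clampRect hL1.le hL2.le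
  have Cgy := cy2.comp_clampRect hL1.le hL2.le
  have dfx := fun s (hs : s ∈ Ioo 0 L1) y => hasDerivAt_fst_comp_clampRect hL2.le hu1 hs y
  have dgx := fun s (hs : s ∈ Ioo 0 L1) y => hasDerivAt_fst_comp_clampRect hL2.le hu2 hs y
  have dfy := fun x s (hs : s ∈ Ioo 0 L2) => hasDerivAt_snd_comp_clampRect hL1.le hu1 x hs
  have dgy := fun x s (hs : s ∈ Ioo 0 L2) => hasDerivAt_snd_comp_clampRect hL1.le hu2 x hs
  set f := u1 ∘ P
  set g := u2 ∘ P
  set fx := pdx L1 L2 u1 ∘ P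
  set fy := pdy L1 L2 u1 ∘ P
  set gx := pdx L1 L2 u2 ∘ P
  set gy := pdy L1 L2 u2 ∘ P
  have m0 : (0 : ℝ) ∈ Icc 0 L1 := ⟨le_rfl, hL1.le⟩
  have m1 : L1 ∈ Icc 0 L1 := ⟨hL1.le, le_rfl⟩
  have n0 : (0 : ℝ) ∈ Icc 0 L2 := ⟨le_rfl, hL2.le⟩
  have n1 : L2 ∈ Icc 0 L2 := ⟨hL2.le, le_rfl⟩
  have hhor : ∀ a b y, (a, b) ≠ ((0 : ℝ), (0 : ℝ)) → y ∈ Icc 0 L2 →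
      (∀ x ∈ Icc 0 L1, a * u1 (x, y) + b * u2 (x, y) = 0) →
      ∀ t ∈ Ioo 0 L1, f (t, y) * gx (t, y) - g (t, y) * fx (t, y) = 0 :=
    fun a b y h0 hy h t ht => det_eq_zero_of_hasDerivAt (p := fun s => f (s, y))
      (q := fun s => g (s, y)) h0 ht
      (fun r hr => by simpa [f, g, hPeq (p := (r, y)) ⟨hr, hy⟩] using h r hr)
      (dfx t ht y) (dgx t ht y)
  have hver : ∀ a b x, (a, b) ≠ ((0 : ℝ), (0 : ℝ)) → x ∈ Icc 0 L1 →
      (∀ y ∈ Icc 0 L2, a * u1 (x, y) + b * u2 (x, y) = 0) →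
      (∫ y in (0 : ℝ)..L2, f (x, y) * gy (x, y)) -
        (∫ y in (0 : ℝ)..L2, g (x, y) * fy (x, y)) = 0 := by
    intro a b x h0 hx h
    have hzero : EqOn (fun y => f (x, y) * gy (x, y) - g (x, y) * fy (x, y)) (fun _ => 0)
        (Icc 0 L2) := by
      refine Set.EqOn.of_subset_closure (s := Ioo 0 L2) (fun y hy => ?_)
        (Continuous.continuousOn (by fun_prop)) continuousOn_const Ioo_subset_Icc_self
        (closure_Ioo hL2.ne).ge
      exact det_eq_zero_of_hasDerivAt (p := fun y => f (x, y)) (q := fun y => g (x, y)) h0 hy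
        (fun r hr => by simpa [f, g, hPeq (p := (x, r)) ⟨hx, hr⟩] using h r hr)
        (dfy x y hy) (dgy x y hy)
    rw [← intervalIntegral.integral_sub
      (Continuous.intervalIntegrable (by fun_prop) _ _)
      (Continuous.intervalIntegrable (by fun_prop) _ _),
      intervalIntegral.integral_congr (g := fun _ => (0 : ℝ)) (by rwa [uIcc_of_le hL2.le])]
    simp
  let J : ℝ × ℝ → ℝ := fun p => fx p * gy p - fy p * gx p
  have CJ : Continuous J := by fun_prop
  have hJP : ∀ p, J p = μ2 (P p) * (fy p ^ 2 + gy p ^ 2) := fun p => hJ (P p) (hPmem p)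
  have hJ0 : ∀ p, 0 ≤ J p := fun p => by
    rw [hJP]
    have := hc0.le.trans (hμ2c _ (hPmem p))
    positivity
  let G : ℝ → ℝ := fun s => (∫ y in (0 : ℝ)..L2, f (s, y) * gy (s, y)) -
    ∫ y in (0 : ℝ)..L2, g (s, y) * fy (s, y)
  have CG : Continuous G :=
    (intervalIntegral.continuous_parametric_intervalIntegral_of_continuous' (by fun_prop) _ _).sub
      (intervalIntegral.continuous_parametric_intervalIntegral_of_continuous' (by fun_prop) _ _)
  have hG0 : G 0 = 0 := hver aW bW 0 hW0 m0 hW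
  have hG1 : G L1 = 0 := hver aE bE L1 hE0 m1 hE
  have dG : ∀ t ∈ Ioo 0 L1, HasDerivAt G (2 * ∫ y in (0 : ℝ)..L2, J (t, y)) t := by
    intro t ht
    have h1 := hasDerivAt_integral_mul_partial hL2.le Cf Cfx Cfy Cg Cgx Cgy dfx dgx dfy dgy ht
    have h2 := hasDerivAt_integral_mul_partial hL2.le Cg Cgx Cgy Cf Cfx Cfy dgx dfx dgy dfy ht
    have hneg : (∫ y in (0 : ℝ)..L2, (gx (t, y) * fy (t, y) - gy (t, y) * fx (t, y))) =
        -∫ y in (0 : ℝ)..L2, J (t, y) := by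
      rw [← intervalIntegral.integral_neg]
      congr 1
      funext y
      simp only [J]
      ring
    refine (h1.sub h2).congr_deriv ?_
    rw [hneg]
    change (∫ y in (0 : ℝ)..L2, J (t, y)) + _ - _ = _
    linear_combination hhor aN bN L2 hN0 n1 hN t ht - hhor aS bS 0 hS0 n0 hS t ht
  have hmono : MonotoneOn G (Icc 0 L1) := by
    refine monotoneOn_of_deriv_nonneg (convex_Icc _ _) CG.continuousOn ?_ ?_
    · rw [interior_Icc]
      exact fun t ht => (dG t ht).differentiableAt.differentiableWithinAt
    · rw [interior_Icc]
      intro t ht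
      rw [(dG t ht).deriv]
      exact mul_nonneg zero_le_two
        (intervalIntegral.integral_nonneg hL2.le fun y _ => hJ0 (t, y))
  have hGz : ∀ t ∈ Icc 0 L1, G t = 0 := fun t ht =>
    le_antisymm ((hmono ht m1 ht.2).trans_eq hG1) (hG0.symm.trans_le (hmono m0 ht ht.1))
  have hJz : ∀ p ∈ Om L1 L2, J p = 0 := by
    rintro ⟨t, y⟩ ⟨ht, hy⟩
    have hint : 2 * (∫ y in (0 : ℝ)..L2, J (t, y)) = 0 := by
      refine (dG t ht).unique ((hasDerivAt_const t (0 : ℝ)).congr_of_eventuallyEq ?_)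
      filter_upwards [Ioo_mem_nhds ht.1 ht.2] with r hr
      exact hGz r (Ioo_subset_Icc_self hr)
    by_contra hne
    have hpos : 0 < ∫ y in (0 : ℝ)..L2, J (t, y) :=
      intervalIntegral.integral_pos hL2 (Continuous.continuousOn (by fun_prop))
        (fun z _ => hJ0 (t, z))
        ⟨y, Ioo_subset_Icc_self hy, lt_of_le_of_ne (hJ0 (t, y)) (Ne.symm hne)⟩
    linarith
  have hy12 : ∀ p ∈ Rect L1 L2, pdy L1 L2 u1 p = 0 ∧ pdy L1 L2 u2 p = 0 := by
    intro p hp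
    have h := hJP p
    rw [extend J CJ.continuousOn hJz p hp] at h
    simp only [fy, gy, Function.comp, hPeq hp] at h
    have hs := (mul_eq_zero.1 h.symm).resolve_left (hc0.trans_le (hμ2c p hp)).ne'
    constructor <;> nlinarith [sq_nonneg (pdy L1 L2 u1 p), sq_nonneg (pdy L1 L2 u2 p)]
  have hx1 : ∀ p ∈ Rect L1 L2, pdx L1 L2 u1 p = 0 := fun p hp => by
    simpa [hy12 p hp] using pde1 p hp
  have hx2 : ∀ p ∈ Rect L1 L2, pdx L1 L2 u2 p = 0 := fun p hp => by
    simpa [hy12 p hp] using pde2 p hp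
  intro p hp
  have e1 : ∀ q ∈ Rect L1 L2, u1 q = u1 p := fun q hq =>
    eq_of_pdx_pdy_eq_zero hu1 hx1 (fun r hr => (hy12 r hr).1) hq hp
  have e2 : ∀ q ∈ Rect L1 L2, u2 q = u2 p := fun q hq =>
    eq_of_pdx_pdy_eq_zero hu2 hx2 (fun r hr => (hy12 r hr).2) hq hp
  have bW' := hW 0 n0
  have bE' := hE 0 n0
  have bS' := hS 0 m0
  have bN' := hN 0 m0
  rw [e1 _ ⟨m0, n0⟩, e2 _ ⟨m0, n0⟩] at bW' bS'
  rw [e1 _ ⟨m1, n0⟩, e2 _ ⟨m1, n0⟩] at bE'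
  rw [e1 _ ⟨m0, n1⟩, e2 _ ⟨m0, n1⟩] at bN'
  have hv : (![u1 p, u2 p] : Fin 2 → ℝ) = 0 := by
    refine Matrix.eq_zero_of_mulVec_eq_zero_of_rank hrank ?_
    ext i
    fin_cases i <;> simpa [Matrix.mulVec, dotProduct, Fin.sum_univ_two]
  exact ⟨congrFun hv 0, congrFun hv 1⟩
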